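/- Let h > 0 be a real number with P(h) = 0. Then there exists a constant K₂ > 0 such that 1 ≤ ∑_{ω ∈ L_n} c_ω^h ≤ K₂ for every integer n ≥ 1. -/

import Mathlib

open Filter

/-- The weight `c_ω` of a word `ω` over the alphabet `{0,1}` (here `false` is the
letter 0 and `true` is the letter 1): the product of `c0` over letters 0 and `c1`
over letters 1. -/
noncomputable def wt (c0 c1 : ℝ) (w : List Bool) : ℝ :=
  (w.map fun b => if b then c1 else c0).prod

/-- All words of length `n` over the alphabet `{0,1}`. -/
def allWords : ℕ → Finset (List Bool)
  | 0 => {[]}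
  | n + 1 => (allWords n).biUnion fun w => {false :: w, true :: w}

/-- Membership in the language of the S-gap shift: every maximal block of 0s lying
strictly between two 1s has length in `S`. -/
def InLang (S : Set ℕ) (w : List Bool) : Prop :=
  ∀ u v : List Bool, ∀ m : ℕ,
    w = u ++ [true] ++ List.replicate m false ++ [true] ++ v → m ∈ S

/-- Membership in the core set `G`: words of the form `0^{s₁}1 0^{s₂}1 ⋯ 0^{s_k}1`
with `k ≥ 1` and every `s_i ∈ S`. -/
def InCore (S : Set ℕ) (w : List Bool) : Prop :=
  ∃ bs : List ℕ, bs ≠ [] ∧ (∀ s ∈ bs, s ∈ S) ∧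
    w = (bs.map fun s => List.replicate s false ++ [true]).flatten

/-- `L_n`: the words of length `n` in the language of the S-gap shift. -/
noncomputable def langWords (S : Set ℕ) (n : ℕ) : Finset (List Bool) :=
  @Finset.filter _ (InLang S) (Classical.decPred _) (allWords n)

/-- `G_n`: the core words of length `n`. -/
noncomputable def coreWords (S : Set ℕ) (n : ℕ) : Finset (List Bool) :=
  @Finset.filter _ (InCore S) (Classical.decPred _) (allWords n)

section Weights

variable {a b : ℝ}

lemma wt_cons (x : Bool) (w : List Bool) :
    wt a b (x :: w) = (if x then b else a) * wt a b w := by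
  simp [wt]

lemma wt_append (u v : List Bool) : wt a b (u ++ v) = wt a b u * wt a b v := by
  simp [wt]

lemma wt_replicate_false (k : ℕ) : wt a b (List.replicate k false) = a ^ k := by
  simp [wt]

lemma wt_nonneg (ha : 0 ≤ a) (hb : 0 ≤ b) (w : List Bool) : 0 ≤ wt a b w := by
  induction w with
  | nil => simp [wt]
  | cons x w ih => rw [wt_cons]; cases x <;> simp <;> positivity

lemma wt_rpow (ha : 0 ≤ a) (hb : 0 ≤ b) (t : ℝ) (w : List Bool) :
    wt a b w ^ t = wt (a ^ t) (b ^ t) w := by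
  induction w with
  | nil => simp [wt]
  | cons x w ih =>
    rw [wt_cons, wt_cons, Real.mul_rpow (by cases x <;> simpa) (wt_nonneg ha hb w), ih]
    cases x <;> simp

end Weights

lemma mem_allWords {n : ℕ} {w : List Bool} : w ∈ allWords n ↔ w.length = n := by
  induction n generalizing w with
  | zero => simp [allWords]
  | succ n ih =>
    rcases w with _ | ⟨x, w⟩
    · simp [allWords]
    · cases x <;> simp [allWords, ih]

lemma mem_langWords {S : Set ℕ} {n : ℕ} {w : List Bool} :
    w ∈ langWords S n ↔ w.length = n ∧ InLang S w := by
  simp [langWords, mem_allWords]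

lemma InLang.of_append_left {S : Set ℕ} {u v : List Bool} (h : InLang S (u ++ v)) :
    InLang S u := by
  intro x y m hu
  exact h x (y ++ v) m (by simp [hu])

lemma InLang.of_append_right {S : Set ℕ} {u v : List Bool} (h : InLang S (u ++ v)) :
    InLang S v := by
  intro x y m hv
  exact h (u ++ x) y m (by simp [hv])

lemma inLang_nil (S : Set ℕ) : InLang S [] := by
  intro u v m h
  simp at h

lemma inLang_cons_false {S : Set ℕ} {w : List Bool} :
    InLang S (false :: w) ↔ InLang S w := by
  refine ⟨fun h => InLang.of_append_right (u := [false]) h, fun h u v m hw => ?_⟩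
  rcases u with _ | ⟨x, u⟩
  · simp at hw
  · simp only [List.cons_append, List.cons.injEq] at hw
    exact h u v m hw.2

lemma inLang_cons_true {S : Set ℕ} {w : List Bool} :
    InLang S (true :: w) ↔
      InLang S w ∧ ∀ m v, w = List.replicate m false ++ true :: v → m ∈ S := by
  refine ⟨fun h => ⟨InLang.of_append_right (u := [true]) h, fun m v hw => ?_⟩,
    fun h u v m hw => ?_⟩
  · exact h [] v m (by simp [hw])
  · rcases u with _ | ⟨x, u⟩
    · exact h.2 m v (by simpa using hw)
    · simp only [List.cons_append, List.cons.injEq] at hw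
      exact h.1 u v m hw.2

lemma inLang_replicate_false_append {S : Set ℕ} {w : List Bool} (k : ℕ) :
    InLang S (List.replicate k false ++ w) ↔ InLang S w := by
  induction k with
  | zero => simp
  | succ k ih => simpa [List.replicate_succ, inLang_cons_false] using ih

lemma replicate_false_append_true_inj {s m : ℕ} {u v : List Bool}
    (h : List.replicate s false ++ true :: u = List.replicate m false ++ true :: v) :
    s = m := by
  induction s generalizing m with
  | zero => cases m <;> simp_all [List.replicate_succ]
  | succ s ih =>
    rcases m with _ | m
    · simp [List.replicate_succ] at h
    · simp only [List.replicate_succ, List.cons_append, List.cons.injEq, true_and] at h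
      rw [ih h]

/-- The word `0^{s₁}1 0^{s₂}1 ⋯ 0^{s_k}1`, possibly empty. -/
def blockWord (bs : List ℕ) : List Bool :=
  (bs.map fun s => List.replicate s false ++ [true]).flatten

lemma blockWord_cons (s : ℕ) (bs : List ℕ) :
    blockWord (s :: bs) = List.replicate s false ++ true :: blockWord bs := by
  simp [blockWord]

lemma blockWord_append (bs cs : List ℕ) :
    blockWord (bs ++ cs) = blockWord bs ++ blockWord cs := by
  simp [blockWord]

lemma inLang_true_cons_blockWord {S : Set ℕ} {bs : List ℕ} (h : ∀ s ∈ bs, s ∈ S) :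
    InLang S (true :: blockWord bs) := by
  induction bs with
  | nil =>
    rw [inLang_cons_true]
    exact ⟨inLang_nil S, fun m v h => by simp [blockWord] at h⟩
  | cons s bs ih =>
    rw [inLang_cons_true, blockWord_cons, inLang_replicate_false_append]
    refine ⟨ih fun t ht => h t (by simp [ht]), fun m v hm => ?_⟩
    rw [← replicate_false_append_true_inj hm]
    exact h s (by simp)

lemma InLang.eq_replicate_or_exists {S : Set ℕ} {w : List Bool} (hw : InLang S w) :
    w = List.replicate w.length false ∨
      ∃ k j bs, (∀ s ∈ bs, s ∈ S) ∧
        w = List.replicate k false ++ true :: (blockWord bs ++ List.replicate j false) := by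
  induction w with
  | nil => simp
  | cons x w ih =>
    cases x
    · rcases ih (inLang_cons_false.1 hw) with h | ⟨k, j, bs, hbs, h⟩
      · left
        simpa [List.replicate_succ] using h
      · exact .inr ⟨k + 1, j, bs, hbs, by simp [List.replicate_succ, h]⟩
    · rw [inLang_cons_true] at hw
      rcases ih hw.1 with h | ⟨k, j, bs, hbs, h⟩
      · exact .inr ⟨0, w.length, [], by simp, by simpa [blockWord] using h⟩
      · refine .inr ⟨0, j, k :: bs, ?_, by simp [blockWord_cons, h]⟩
        simpa using ⟨hw.2 k _ h, hbs⟩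

/-- The words `0^{s₁}1 ⋯ 0^{s_k}1` of length `n` with all `s_i ∈ S`, including the empty word. -/
noncomputable def blockWords (S : Set ℕ) (n : ℕ) : Finset (List Bool) :=
  @Finset.filter _ (fun w => ∃ bs, (∀ s ∈ bs, s ∈ S) ∧ w = blockWord bs)
    (Classical.decPred _) (allWords n)

lemma mem_blockWords {S : Set ℕ} {n : ℕ} {w : List Bool} :
    w ∈ blockWords S n ↔ w.length = n ∧ ∃ bs, (∀ s ∈ bs, s ∈ S) ∧ w = blockWord bs := by
  simp [blockWords, mem_allWords]

lemma blockWords_subset_langWords (S : Set ℕ) (n : ℕ) : blockWords S n ⊆ langWords S n := by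
  intro w hw
  obtain ⟨hn, bs, hbs, rfl⟩ := mem_blockWords.1 hw
  exact mem_langWords.2 ⟨hn, (inLang_cons_true.1 (inLang_true_cons_blockWord hbs)).1⟩

lemma sum_biUnion_le {ι α : Type*} [DecidableEq α] {f : α → ℝ} (hf : ∀ x, 0 ≤ f x)
    (s : Finset ι) (t : ι → Finset α) :
    ∑ x ∈ s.biUnion t, f x ≤ ∑ i ∈ s, ∑ x ∈ t i, f x := by
  classical
  induction s using Finset.induction_on with
  | empty => simp
  | insert i s hi ih =>
    rw [Finset.biUnion_insert, Finset.sum_insert hi]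
    have hinter : 0 ≤ ∑ x ∈ t i ∩ s.biUnion t, f x := Finset.sum_nonneg fun x _ => hf x
    linarith [Finset.sum_union_inter (s₁ := t i) (s₂ := s.biUnion t) (f := f)]

section Sums

variable {S : Set ℕ} {a b : ℝ}

lemma sum_langWords_pos (ha : 0 < a) (hb : 0 ≤ b) (n : ℕ) :
    0 < ∑ w ∈ langWords S n, wt a b w := by
  have hmem : List.replicate n false ∈ langWords S n :=
    mem_langWords.2 ⟨by simp, by
      simpa using (inLang_replicate_false_append n).2 (inLang_nil S)⟩
  calc 0 < wt a b (List.replicate n false) := by rw [wt_replicate_false]; positivity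
    _ ≤ _ := Finset.single_le_sum (fun w _ => wt_nonneg ha.le hb w) hmem

lemma sum_langWords_add_le (ha : 0 ≤ a) (hb : 0 ≤ b) (m n : ℕ) :
    ∑ w ∈ langWords S (m + n), wt a b w ≤
      (∑ w ∈ langWords S m, wt a b w) * ∑ w ∈ langWords S n, wt a b w := by
  classical
  rw [Finset.sum_mul_sum, ← Finset.sum_product']
  simp only [← wt_append]
  have hinj : Set.InjOn (fun p : List Bool × List Bool => p.1 ++ p.2)
      (langWords S m ×ˢ langWords S n : Finset _) := by
    rintro ⟨u, v⟩ hp ⟨u', v'⟩ hp' he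
    simp only [Finset.coe_product, Set.mem_prod, Finset.mem_coe, mem_langWords] at hp hp'
    simpa using List.append_inj he (hp.1.1.trans hp'.1.1.symm)
  rw [← Finset.sum_image (f := wt a b) hinj]
  refine Finset.sum_le_sum_of_subset_of_nonneg (fun w hw => ?_)
    fun w _ _ => wt_nonneg ha hb w
  obtain ⟨hl, hw⟩ := mem_langWords.1 hw
  rw [← List.take_append_drop m w] at hw
  refine Finset.mem_image.2 ⟨(w.take m, w.drop m), ?_, by simp⟩
  simp [mem_langWords, hl, hw.of_append_left, hw.of_append_right]

lemma sum_langWords_mul_le (ha : 0 ≤ a) (hb : 0 ≤ b) (n k : ℕ) :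
    ∑ w ∈ langWords S (k * n), wt a b w ≤ (∑ w ∈ langWords S n, wt a b w) ^ k := by
  induction k with
  | zero =>
    have : langWords S 0 ⊆ {[]} := fun w hw => by
      simpa using (mem_langWords.1 hw).1
    rw [zero_mul, pow_zero]
    exact (Finset.sum_le_sum_of_subset_of_nonneg this fun w _ _ => wt_nonneg ha hb w).trans
      (by simp [wt])
  | succ k ih =>
    rw [Nat.succ_mul, pow_succ]
    exact (sum_langWords_add_le ha hb _ _).trans (mul_le_mul_of_nonneg_right ih
      (Finset.sum_nonneg fun w _ => wt_nonneg ha hb w))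

lemma sum_blockWords_mul_le (ha : 0 ≤ a) (hb : 0 ≤ b) (m n : ℕ) :
    (∑ w ∈ blockWords S m, wt a b w) * ∑ w ∈ blockWords S n, wt a b w ≤
      ∑ w ∈ blockWords S (m + n), wt a b w := by
  classical
  rw [Finset.sum_mul_sum, ← Finset.sum_product']
  simp only [← wt_append]
  have hinj : Set.InjOn (fun p : List Bool × List Bool => p.1 ++ p.2)
      (blockWords S m ×ˢ blockWords S n : Finset _) := by
    rintro ⟨u, v⟩ hp ⟨u', v'⟩ hp' he
    simp only [Finset.coe_product, Set.mem_prod, Finset.mem_coe, mem_blockWords] at hp hp'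
    simpa using List.append_inj he (hp.1.1.trans hp'.1.1.symm)
  rw [← Finset.sum_image (f := wt a b) hinj]
  refine Finset.sum_le_sum_of_subset_of_nonneg (fun w hw => ?_)
    fun w _ _ => wt_nonneg ha hb w
  obtain ⟨⟨u, v⟩, hp, rfl⟩ := Finset.mem_image.1 hw
  obtain ⟨hu, hv⟩ := Finset.mem_product.1 hp
  obtain ⟨hm, bs, hbs, rfl⟩ := mem_blockWords.1 hu
  obtain ⟨hn, cs, hcs, rfl⟩ := mem_blockWords.1 hv
  refine mem_blockWords.2 ⟨by simp [hm, hn], bs ++ cs, fun s hs => ?_, by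
    simp [blockWord_append]⟩
  exact (List.mem_append.1 hs).elim (hbs s) (hcs s)

lemma sum_blockWords_pow_le (ha : 0 ≤ a) (hb : 0 ≤ b) (n k : ℕ) :
    (∑ w ∈ blockWords S n, wt a b w) ^ k ≤ ∑ w ∈ blockWords S (k * n), wt a b w := by
  induction k with
  | zero =>
    have hmem : [] ∈ blockWords S 0 := mem_blockWords.2 ⟨rfl, [], by simp, rfl⟩
    simpa [wt] using Finset.single_le_sum (fun w _ => wt_nonneg ha hb w) hmem
  | succ k ih =>
    rw [Nat.succ_mul, pow_succ]
    exact (mul_le_mul_of_nonneg_right ih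
      (Finset.sum_nonneg fun w _ => wt_nonneg ha hb w)).trans (sum_blockWords_mul_le ha hb _ _)

lemma sum_langWords_le (ha : 0 ≤ a) (ha1 : a < 1) (hb : 0 ≤ b)
    (hS : ∀ n, ∑ w ∈ blockWords S n, wt a b w ≤ 1) (n : ℕ) :
    ∑ w ∈ langWords S n, wt a b w ≤ 1 + b * ((1 - a)⁻¹ * (1 - a)⁻¹) := by
  classical
  let F : ℕ × ℕ → List Bool → List Bool := fun p g =>
    List.replicate p.1 false ++ true :: (g ++ List.replicate p.2 false)
  let I : ℕ × ℕ → Finset (List Bool) := fun p =>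
    (blockWords S (n - 1 - p.1 - p.2)).image (F p)
  have hsub : langWords S n ⊆
      {List.replicate n false} ∪ (Finset.range n ×ˢ Finset.range n).biUnion I := by
    intro w hw
    obtain ⟨hn, hw⟩ := mem_langWords.1 hw
    rw [Finset.mem_union]
    rcases hw.eq_replicate_or_exists with h | ⟨k, j, bs, hbs, rfl⟩
    · left
      rw [← hn]
      simpa using h
    · right
      simp only [List.length_append, List.length_replicate, List.length_cons] at hn
      refine Finset.mem_biUnion.2 ⟨(k, j), ?_, Finset.mem_image.2 ⟨blockWord bs, ?_, rfl⟩⟩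
      · simp only [Finset.mem_product, Finset.mem_range]
        omega
      · exact mem_blockWords.2 ⟨by dsimp only; omega, bs, hbs, rfl⟩
  have hI (p : ℕ × ℕ) : ∑ w ∈ I p, wt a b w ≤ b * (a ^ p.1 * a ^ p.2) := by
    have hinj : Set.InjOn (F p) (blockWords S (n - 1 - p.1 - p.2)) := by
      intro u _ v _ he
      simpa [F] using he
    have hF (g : List Bool) : wt a b (F p g) = b * (a ^ p.1 * a ^ p.2) * wt a b g := by
      simp only [F, wt_append, wt_cons, wt_replicate_false, if_true]
      ring
    rw [Finset.sum_image hinj]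
    simp only [hF]
    rw [← Finset.mul_sum]
    exact mul_le_of_le_one_right (by positivity) (hS _)
  have hgeom : ∑ k ∈ Finset.range n, a ^ k ≤ (1 - a)⁻¹ := by
    rw [← tsum_geometric_of_lt_one ha ha1]
    exact (summable_geometric_of_lt_one ha ha1).sum_le_tsum _ fun k _ => by positivity
  have hnn : ∀ w, 0 ≤ wt a b w := wt_nonneg ha hb
  calc ∑ w ∈ langWords S n, wt a b w
      ≤ ∑ w ∈ {List.replicate n false} ∪ (Finset.range n ×ˢ Finset.range n).biUnion I,
          wt a b w := Finset.sum_le_sum_of_subset_of_nonneg hsub fun w _ _ => hnn w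
    _ ≤ a ^ n + ∑ w ∈ (Finset.range n ×ˢ Finset.range n).biUnion I, wt a b w := by
      rw [← wt_replicate_false (b := b), ← Finset.sum_singleton (wt a b),
        ← Finset.sum_union_inter]
      exact le_add_of_nonneg_right (Finset.sum_nonneg fun w _ => hnn w)
    _ ≤ 1 + ∑ p ∈ Finset.range n ×ˢ Finset.range n, ∑ w ∈ I p, wt a b w := by
      refine add_le_add (pow_le_one₀ ha ha1.le) ?_
      exact sum_biUnion_le hnn _ _
    _ ≤ 1 + ∑ p ∈ Finset.range n ×ˢ Finset.range n, b * (a ^ p.1 * a ^ p.2) := by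
      gcongr with p
      exact hI p
    _ = 1 + b * ((∑ k ∈ Finset.range n, a ^ k) * ∑ k ∈ Finset.range n, a ^ k) := by
      rw [← Finset.mul_sum, Finset.sum_mul_sum, ← Finset.sum_product']
    _ ≤ 1 + b * ((1 - a)⁻¹ * (1 - a)⁻¹) := by
      gcongr

end Sums

section Growth

variable {Z : ℕ → ℝ} {x : ℝ} {n : ℕ}

lemma tendsto_log_mul_div (hn : 1 ≤ n)
    (hlim : Tendsto (fun n : ℕ => (1 / (n : ℝ)) * Real.log (Z n)) atTop (nhds 0)) :
    Tendsto (fun k : ℕ => Real.log (Z (k * n)) / k) atTop (nhds 0) := by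
  have hsub : Tendsto (fun k : ℕ => k * n) atTop atTop :=
    tendsto_id.atTop_mul_const' hn
  have hn0 : (n : ℝ) ≠ 0 := by positivity
  have := (hlim.comp hsub).const_mul (n : ℝ)
  rw [mul_zero] at this
  refine this.congr fun k => ?_
  simp only [Function.comp_apply, Nat.cast_mul]
  field_simp

lemma one_le_of_le_pow (hn : 1 ≤ n) (hZ : ∀ n, 0 < Z n) (hx : 0 < x)
    (hlim : Tendsto (fun n : ℕ => (1 / (n : ℝ)) * Real.log (Z n)) atTop (nhds 0))
    (h : ∀ k, Z (k * n) ≤ x ^ k) : 1 ≤ x := by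
  rw [← Real.log_nonneg_iff hx]
  refine le_of_tendsto (tendsto_log_mul_div hn hlim) ?_
  filter_upwards [eventually_gt_atTop 0] with k hk
  rw [div_le_iff₀' (by positivity), ← Real.log_pow]
  exact Real.log_le_log (hZ _) (h k)

lemma le_one_of_pow_le (hn : 1 ≤ n)
    (hlim : Tendsto (fun n : ℕ => (1 / (n : ℝ)) * Real.log (Z n)) atTop (nhds 0))
    (h : ∀ k, x ^ k ≤ Z (k * n)) : x ≤ 1 := by
  rcases le_or_gt x 0 with hx | hx
  · linarith
  rw [← Real.log_nonpos_iff hx.le]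
  refine ge_of_tendsto (tendsto_log_mul_div hn hlim) ?_
  filter_upwards [eventually_gt_atTop 0] with k hk
  rw [le_div_iff₀' (by positivity), ← Real.log_pow]
  exact Real.log_le_log (by positivity) (h k)

end Growth

/-- If h > 0 and P(h) = 0, there is K₂ > 0 with
1 ≤ ∑_{ω ∈ L_n} c_ω^h ≤ K₂ for every n ≥ 1. -/
theorem stmt3
    (S : Set ℕ) (hS : S.Infinite)
    (c0 c1 cb0 cb1 : ℝ)
    (hc0 : 0 < c0) (hc0b : c0 ≤ cb0) (hcb0 : cb0 < 1)
    (hc1 : 0 < c1) (hc1b : c1 ≤ cb1) (hcb1 : cb1 < 1)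
    (P Pb : ℝ → ℝ)
    (hP : ∀ t : ℝ, Filter.Tendsto
      (fun n : ℕ => (1 / (n : ℝ)) * Real.log (∑ ω ∈ langWords S n, wt c0 c1 ω ^ t))
      Filter.atTop (nhds (P t)))
    (hPb : ∀ t : ℝ, Filter.Tendsto
      (fun n : ℕ => (1 / (n : ℝ)) * Real.log (∑ ω ∈ langWords S n, wt cb0 cb1 ω ^ t))
      Filter.atTop (nhds (Pb t)))
    (h : ℝ) (hh : 0 < h) (hPh : P h = 0) :
    ∃ K₂ : ℝ, 0 < K₂ ∧ ∀ n : ℕ, 1 ≤ n →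
      1 ≤ ∑ ω ∈ langWords S n, wt c0 c1 ω ^ h ∧
      ∑ ω ∈ langWords S n, wt c0 c1 ω ^ h ≤ K₂ := by
  have hlim := hP h
  rw [hPh] at hlim
  simp only [wt_rpow hc0.le hc1.le] at hlim ⊢
  have ha : 0 < c0 ^ h := Real.rpow_pos_of_pos hc0 h
  have hb : 0 < c1 ^ h := Real.rpow_pos_of_pos hc1 h
  have ha1 : c0 ^ h < 1 := Real.rpow_lt_one hc0.le (hc0b.trans_lt hcb0) hh
  have hpos := sum_langWords_pos (S := S) ha hb.le
  have hblock (n : ℕ) : ∑ w ∈ blockWords S n, wt (c0 ^ h) (c1 ^ h) w ≤ 1 := by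
    rcases Nat.eq_zero_or_pos n with rfl | hn
    · have hsub : blockWords S 0 ⊆ {[]} := fun w hw => by
        simpa using (mem_blockWords.1 hw).1
      exact (Finset.sum_le_sum_of_subset_of_nonneg hsub
        fun w _ _ => wt_nonneg ha.le hb.le w).trans (by simp [wt])
    · exact le_one_of_pow_le hn hlim fun k => (sum_blockWords_pow_le ha.le hb.le n k).trans
        (Finset.sum_le_sum_of_subset_of_nonneg (blockWords_subset_langWords S _)
          fun w _ _ => wt_nonneg ha.le hb.le w)
  refine ⟨1 + c1 ^ h * ((1 - c0 ^ h)⁻¹ * (1 - c0 ^ h)⁻¹), ?_, fun n hn =>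
    ⟨?_, sum_langWords_le ha.le ha1 hb.le hblock n⟩⟩
  · have := sub_pos.2 ha1
    positivity
  · exact one_le_of_le_pow hn hpos (hpos n) hlim (sum_langWords_mul_le ha.le hb.le n)
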